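/- arXiv:2308.14282 — 11 statements merged into one kernel-verified Lean document; each statement's English description precedes it below -/
import Mathlib

section
/- Let λ₁, λ₂ be real numbers with |λ₁| + |λ₂| ≤ 1/2, and define C(u,v) = uv + (2/π²)λ₁ sin(πu)sin(πv) + (1/(2π²))λ₂ sin(2πu)sin(2πv) on [0,1]². Then C is a copula: C(u,0) = 0, C(0,v) = 0, C(u,1) = u and C(1,v) = v for all u,v ∈ [0,1], and for all 0 ≤ u₁ ≤ u₂ ≤ 1 and 0 ≤ v₁ ≤ v₂ ≤ 1 the rectangle inequality C(u₂,v₂) − C(u₂,v₁) − C(u₁,v₂) + C(u₁,v₁) ≥ 0 holds. -/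
open Real

/-- The sine copula with parameters `l1, l2`. -/
noncomputable def sineCopula (l1 l2 u v : ℝ) : ℝ :=
  u * v + (2 / π ^ 2) * l1 * Real.sin (π * u) * Real.sin (π * v)
    + (1 / (2 * π ^ 2)) * l2 * Real.sin (2 * π * u) * Real.sin (2 * π * v)

/-- Sine is 1-Lipschitz. -/
theorem sin_sub_abs_le (a b : ℝ) (h : a ≤ b) : |Real.sin b - Real.sin a| ≤ b - a := by
  rw [Real.sin_sub_sin, abs_mul, abs_mul]
  have h1 : |Real.sin ((b - a) / 2)| ≤ (b - a) / 2 := by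
    have h0 : 0 ≤ (b - a) / 2 := by linarith
    have h2 := Real.abs_sin_le_abs (x := (b - a) / 2)
    rwa [abs_of_nonneg h0] at h2
  have h2 := Real.abs_cos_le_one ((b + a) / 2)
  have h3 := abs_nonneg (Real.sin ((b - a) / 2))
  have h4 := abs_nonneg (Real.cos ((b + a) / 2))
  rw [abs_two]
  nlinarith

theorem sineCopula_isCopula (l1 l2 : ℝ) (h : |l1| + |l2| ≤ 1 / 2) :
    (∀ u ∈ Set.Icc (0 : ℝ) 1, sineCopula l1 l2 u 0 = 0) ∧
    (∀ v ∈ Set.Icc (0 : ℝ) 1, sineCopula l1 l2 0 v = 0) ∧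
    (∀ u ∈ Set.Icc (0 : ℝ) 1, sineCopula l1 l2 u 1 = u) ∧
    (∀ v ∈ Set.Icc (0 : ℝ) 1, sineCopula l1 l2 1 v = v) ∧
    (∀ u1 u2 v1 v2 : ℝ, 0 ≤ u1 → u1 ≤ u2 → u2 ≤ 1 → 0 ≤ v1 → v1 ≤ v2 → v2 ≤ 1 →
      0 ≤ sineCopula l1 l2 u2 v2 - sineCopula l1 l2 u2 v1
        - sineCopula l1 l2 u1 v2 + sineCopula l1 l2 u1 v1) := by
  refine ⟨?_, ?_, ?_, ?_, ?_⟩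
  · intro u _; simp [sineCopula]
  · intro u _; simp [sineCopula]
  · intro u _; simp [sineCopula]
  · intro u _; simp [sineCopula]
  intro u1 u2 v1 v2 _ hu _ _ hv _
  have hp := Real.pi_pos
  have hpu : π * u1 ≤ π * u2 := by gcongr
  have hpv : π * v1 ≤ π * v2 := by gcongr
  have hpu2 : 2 * π * u1 ≤ 2 * π * u2 := by gcongr
  have hpv2 : 2 * π * v1 ≤ 2 * π * v2 := by gcongr
  have a1 := sin_sub_abs_le _ _ hpu
  have a2 := sin_sub_abs_le _ _ hpv
  have b1 := sin_sub_abs_le _ _ hpu2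
  have b2 := sin_sub_abs_le _ _ hpv2
  have e : sineCopula l1 l2 u2 v2 - sineCopula l1 l2 u2 v1
        - sineCopula l1 l2 u1 v2 + sineCopula l1 l2 u1 v1
      = (u2 - u1) * (v2 - v1)
        + (2 / π ^ 2) * (l1 * ((Real.sin (π * u2) - Real.sin (π * u1))
          * (Real.sin (π * v2) - Real.sin (π * v1))))
        + (1 / (2 * π ^ 2)) * (l2 * ((Real.sin (2 * π * u2) - Real.sin (2 * π * u1))
          * (Real.sin (2 * π * v2) - Real.sin (2 * π * v1)))) := by
    unfold sineCopula; ring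
  rw [e]
  generalize Real.sin (π * u2) - Real.sin (π * u1) = A at *
  generalize Real.sin (π * v2) - Real.sin (π * v1) = B at *
  generalize Real.sin (2 * π * u2) - Real.sin (2 * π * u1) = C at *
  generalize Real.sin (2 * π * v2) - Real.sin (2 * π * v1) = D at *
  have c1 : |l1 * (A * B)| ≤ |l1| * ((π * u2 - π * u1) * (π * v2 - π * v1)) := by
    rw [abs_mul, abs_mul]
    have : 0 ≤ π * u2 - π * u1 := by linarith
    gcongr
  have c2 : |l2 * (C * D)|
      ≤ |l2| * ((2 * π * u2 - 2 * π * u1) * (2 * π * v2 - 2 * π * v1)) := by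
    rw [abs_mul, abs_mul]
    have : 0 ≤ 2 * π * u2 - 2 * π * u1 := by linarith
    gcongr
  have d1 := mul_le_mul_of_nonneg_left ((abs_le.1 c1).1) (show 0 ≤ 2 / π ^ 2 by positivity)
  have d2 := mul_le_mul_of_nonneg_left ((abs_le.1 c2).1)
    (show 0 ≤ 1 / (2 * π ^ 2) by positivity)
  have f1 : 2 / π ^ 2 * -(|l1| * ((π * u2 - π * u1) * (π * v2 - π * v1)))
      = -(2 * |l1| * ((u2 - u1) * (v2 - v1))) := by
    field_simp
  have f2 : 1 / (2 * π ^ 2) * -(|l2| * ((2 * π * u2 - 2 * π * u1) * (2 * π * v2 - 2 * π * v1)))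
      = -(2 * |l2| * ((u2 - u1) * (v2 - v1))) := by
    field_simp
  rw [f1] at d1
  rw [f2] at d2
  have g : 0 ≤ (u2 - u1) * (v2 - v1) := mul_nonneg (by linarith) (by linarith)
  have k := mul_le_mul_of_nonneg_right h g
  linarith
end

section
/- Let λ₁, λ₂, μ₁, μ₂ be real numbers with |λ₁| + |λ₂| + |μ₁| + |μ₂| ≤ 1/2, and define C(u,v) = uv + (1/(2π²))(λ₁ sin(2πu)sin(2πv) + μ₁(1 − cos(2πu))(1 − cos(2πv))) + (1/(8π²))(λ₂ sin(4πu)sin(4πv) + μ₂(1 − cos(4πu))(1 − cos(4πv))) on [0,1]². Then C is a copula: C(u,0) = 0, C(0,v) = 0, C(u,1) = u and C(1,v) = v for all u,v ∈ [0,1], and for all 0 ≤ u₁ ≤ u₂ ≤ 1 and 0 ≤ v₁ ≤ v₂ ≤ 1 the rectangle inequality C(u₂,v₂) − C(u₂,v₁) − C(u₁,v₂) + C(u₁,v₁) ≥ 0 holds. -/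
open Real

/-- The sine-cosine copula with parameters `l1, l2, m1, m2`. -/
noncomputable def sineCosineCopula (l1 l2 m1 m2 u v : ℝ) : ℝ :=
  u * v
    + (1 / (2 * π ^ 2)) * (l1 * Real.sin (2 * π * u) * Real.sin (2 * π * v)
        + m1 * (1 - Real.cos (2 * π * u)) * (1 - Real.cos (2 * π * v)))
    + (1 / (8 * π ^ 2)) * (l2 * Real.sin (4 * π * u) * Real.sin (4 * π * v)
        + m2 * (1 - Real.cos (4 * π * u)) * (1 - Real.cos (4 * π * v)))

lemma abs_sin_diff (k a b : ℝ) (hk : 0 ≤ k) (hab : a ≤ b) :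
    |Real.sin (k * b) - Real.sin (k * a)| ≤ k * (b - a) := by
  have h := Real.lipschitzWith_sin.dist_le_mul (k * b) (k * a)
  simp only [Real.dist_eq, NNReal.coe_one, one_mul] at h
  rwa [← mul_sub, abs_of_nonneg (mul_nonneg hk (sub_nonneg.2 hab))] at h

lemma abs_cos_diff (k a b : ℝ) (hk : 0 ≤ k) (hab : a ≤ b) :
    |Real.cos (k * b) - Real.cos (k * a)| ≤ k * (b - a) := by
  have h := Real.lipschitzWith_cos.dist_le_mul (k * b) (k * a)
  simp only [Real.dist_eq, NNReal.coe_one, one_mul] at h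
  rwa [← mul_sub, abs_of_nonneg (mul_nonneg hk (sub_nonneg.2 hab))] at h

lemma term_bound (l a b k p q c : ℝ) (hc : 0 ≤ c) (hck : c * (k * k) = 2)
    (ha : |a| ≤ k * p) (hb : |b| ≤ k * q) :
    -(|l| * (2 * (p * q))) ≤ c * (l * (a * b)) := by
  have h1 : |a| * |b| ≤ (k * p) * (k * q) :=
    mul_le_mul ha hb (abs_nonneg _) ((abs_nonneg _).trans ha)
  have h2 : |c * (l * (a * b))| ≤ c * (|l| * ((k * p) * (k * q))) := by
    rw [abs_mul, abs_mul, abs_mul, abs_of_nonneg hc]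
    gcongr
  have h3 : c * (|l| * ((k * p) * (k * q))) = |l| * (2 * (p * q)) := by
    rw [← hck]; ring
  rw [h3] at h2
  exact (abs_le.1 h2).1

theorem sineCosineCopula_isCopula (l1 l2 m1 m2 : ℝ)
    (h : |l1| + |l2| + |m1| + |m2| ≤ 1 / 2) :
    (∀ u ∈ Set.Icc (0 : ℝ) 1, sineCosineCopula l1 l2 m1 m2 u 0 = 0) ∧
    (∀ v ∈ Set.Icc (0 : ℝ) 1, sineCosineCopula l1 l2 m1 m2 0 v = 0) ∧
    (∀ u ∈ Set.Icc (0 : ℝ) 1, sineCosineCopula l1 l2 m1 m2 u 1 = u) ∧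
    (∀ v ∈ Set.Icc (0 : ℝ) 1, sineCosineCopula l1 l2 m1 m2 1 v = v) ∧
    (∀ u1 u2 v1 v2 : ℝ, 0 ≤ u1 → u1 ≤ u2 → u2 ≤ 1 → 0 ≤ v1 → v1 ≤ v2 → v2 ≤ 1 →
      0 ≤ sineCosineCopula l1 l2 m1 m2 u2 v2 - sineCosineCopula l1 l2 m1 m2 u2 v1
        - sineCosineCopula l1 l2 m1 m2 u1 v2 + sineCosineCopula l1 l2 m1 m2 u1 v1) := by
  have s4 : Real.sin (4 * π) = 0 := by
    have := Real.sin_nat_mul_pi 4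
    exact_mod_cast this
  have c4 : Real.cos (4 * π) = 1 := by
    have := Real.cos_nat_mul_two_pi 2
    rw [← this]; congr 1; push_cast; ring
  refine ⟨?_, ?_, ?_, ?_, ?_⟩
  · intro u _; simp [sineCosineCopula]
  · intro u _; simp [sineCosineCopula]
  · intro u _; simp [sineCosineCopula, s4, c4]
  · intro u _; simp [sineCosineCopula, s4, c4]
  · intro u1 u2 v1 v2 _ hu _ _ hv _
    have hpi := Real.pi_pos
    have k2 : (0 : ℝ) ≤ 2 * π := by positivity
    have k4 : (0 : ℝ) ≤ 4 * π := by positivity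
    have e2 : 1 / (2 * π ^ 2) * ((2 * π) * (2 * π)) = 2 := by field_simp
    have e4 : 1 / (8 * π ^ 2) * ((4 * π) * (4 * π)) = 2 := by field_simp; norm_num
    have t1 := term_bound l1 _ _ _ _ _ _ (by positivity) e2
      (abs_sin_diff _ _ _ k2 hu) (abs_sin_diff _ _ _ k2 hv)
    have t2 := term_bound m1 _ _ _ _ _ _ (by positivity) e2
      (abs_cos_diff _ _ _ k2 hu) (abs_cos_diff _ _ _ k2 hv)
    have t3 := term_bound l2 _ _ _ _ _ _ (by positivity) e4
      (abs_sin_diff _ _ _ k4 hu) (abs_sin_diff _ _ _ k4 hv)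
    have t4 := term_bound m2 _ _ _ _ _ _ (by positivity) e4
      (abs_cos_diff _ _ _ k4 hu) (abs_cos_diff _ _ _ k4 hv)
    have hD : 0 ≤ (u2 - u1) * (v2 - v1) :=
      mul_nonneg (sub_nonneg.2 hu) (sub_nonneg.2 hv)
    have hS := mul_le_mul_of_nonneg_right h hD
    unfold sineCosineCopula
    generalize 1 / (2 * π ^ 2) = c at *
    generalize 1 / (8 * π ^ 2) = d at *
    linarith
end

section
/- Let λ₁, λ₂ be real numbers with 3|λ₁| + 5|λ₂| ≤ 1, and define C(u,v) = uv + 3λ₁(u²−u)(v²−v) + 5λ₂(2u³−3u²+u)(2v³−3v²+v) on [0,1]². Then C is a copula: C(u,0) = 0, C(0,v) = 0, C(u,1) = u and C(1,v) = v for all u,v ∈ [0,1], and for all 0 ≤ u₁ ≤ u₂ ≤ 1 and 0 ≤ v₁ ≤ v₂ ≤ 1 the rectangle inequality C(u₂,v₂) − C(u₂,v₁) − C(u₁,v₂) + C(u₁,v₁) ≥ 0 holds. -/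
/-- The Legendre (extended FGM) copula with parameters `l1, l2`. -/
def legendreCopula (l1 l2 u v : ℝ) : ℝ :=
  u * v + 3 * l1 * (u ^ 2 - u) * (v ^ 2 - v)
    + 5 * l2 * (2 * u ^ 3 - 3 * u ^ 2 + u) * (2 * v ^ 3 - 3 * v ^ 2 + v)

lemma legendre_aux_one {x y : ℝ} (hx : 0 ≤ x) (hx1 : x ≤ 1) (hy : 0 ≤ y) (hy1 : y ≤ 1) :
    |x + y - 1| ≤ 1 := by
  rw [abs_le]; constructor <;> linarith

lemma legendre_aux_two {x y : ℝ} (hx : 0 ≤ x) (hx1 : x ≤ 1) (hy : 0 ≤ y) (hy1 : y ≤ 1) :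
    |2 * (x ^ 2 + x * y + y ^ 2) - 3 * (x + y) + 1| ≤ 1 := by
  rw [abs_le]; constructor
  · nlinarith [sq_nonneg (x - y), sq_nonneg (x + y - 1)]
  · nlinarith [mul_nonneg hx (sub_nonneg.2 hx1), mul_nonneg hy (sub_nonneg.2 hy1),
      mul_nonneg hx (sub_nonneg.2 hy1), mul_nonneg hy (sub_nonneg.2 hx1)]

lemma legendre_aux_mul {l a b : ℝ} (ha : |a| ≤ 1) (hb : |b| ≤ 1) : -|l| ≤ l * (a * b) := by
  have h1 : |a * b| ≤ 1 := by
    rw [abs_mul]; exact mul_le_one₀ ha (abs_nonneg b) hb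
  have h2 : |l * (a * b)| ≤ |l| := by
    rw [abs_mul]; exact mul_le_of_le_one_right (abs_nonneg l) h1
  exact (abs_le.1 h2).1

theorem legendreCopula_isCopula (l1 l2 : ℝ) (h : 3 * |l1| + 5 * |l2| ≤ 1) :
    (∀ u ∈ Set.Icc (0 : ℝ) 1, legendreCopula l1 l2 u 0 = 0) ∧
    (∀ v ∈ Set.Icc (0 : ℝ) 1, legendreCopula l1 l2 0 v = 0) ∧
    (∀ u ∈ Set.Icc (0 : ℝ) 1, legendreCopula l1 l2 u 1 = u) ∧
    (∀ v ∈ Set.Icc (0 : ℝ) 1, legendreCopula l1 l2 1 v = v) ∧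
    (∀ u1 u2 v1 v2 : ℝ, 0 ≤ u1 → u1 ≤ u2 → u2 ≤ 1 → 0 ≤ v1 → v1 ≤ v2 → v2 ≤ 1 →
      0 ≤ legendreCopula l1 l2 u2 v2 - legendreCopula l1 l2 u2 v1
        - legendreCopula l1 l2 u1 v2 + legendreCopula l1 l2 u1 v1) := by
  refine ⟨?_, ?_, ?_, ?_, ?_⟩
  · intro u _; unfold legendreCopula; ring
  · intro v _; unfold legendreCopula; ring
  · intro u _; unfold legendreCopula; ring
  · intro v _; unfold legendreCopula; ring
  · intro x y z w hx hxy hy hz hzw hw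
    have hx1 := hxy.trans hy
    have hy0 := hx.trans hxy
    have hz1 := hzw.trans hw
    have hw0 := hz.trans hzw
    have k1 := legendre_aux_mul (l := l1) (legendre_aux_one hx hx1 hy0 hy)
      (legendre_aux_one hz hz1 hw0 hw)
    have k2 := legendre_aux_mul (l := l2) (legendre_aux_two hx hx1 hy0 hy)
      (legendre_aux_two hz hz1 hw0 hw)
    have key := mul_nonneg (mul_nonneg (sub_nonneg.2 hxy) (sub_nonneg.2 hzw))
      (show 0 ≤ 1 + 3 * (l1 * ((x + y - 1) * (z + w - 1)))
        + 5 * (l2 * ((2 * (x ^ 2 + x * y + y ^ 2) - 3 * (x + y) + 1)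
          * (2 * (z ^ 2 + z * w + w ^ 2) - 3 * (z + w) + 1))) by linarith)
    refine key.trans_eq ?_
    unfold legendreCopula
    ring
end

section
/- Let N ∈ ℕ, let φ₁,…,φ_N : [0,1] → ℝ be bounded functions such that for each i the infimum mᵢ and supremum Mᵢ of φᵢ over [0,1] satisfy mᵢ ≤ 0 ≤ Mᵢ, and let λ₁,…,λ_N be real numbers. For each i set αᵢ = sup_{x∈[0,1]} φᵢ(x)² if λᵢ < 0, αᵢ = mᵢ·Mᵢ if λᵢ > 0, and αᵢ = 0 if λᵢ = 0. If 1 + Σ_{i=1}^N λᵢαᵢ ≥ 0, then for all u, v ∈ [0,1] one has 1 + Σ_{i=1}^N λᵢ φᵢ(u)φᵢ(v) ≥ 0. -/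
theorem nonneg_criterion (N : ℕ) (φ : Fin N → ℝ → ℝ) (l : Fin N → ℝ)
    (hbddA : ∀ i, BddAbove (φ i '' Set.Icc (0 : ℝ) 1))
    (hbddB : ∀ i, BddBelow (φ i '' Set.Icc (0 : ℝ) 1))
    (hm : ∀ i, sInf (φ i '' Set.Icc (0 : ℝ) 1) ≤ 0)
    (hM : ∀ i, 0 ≤ sSup (φ i '' Set.Icc (0 : ℝ) 1))
    (α : Fin N → ℝ)
    (hα : ∀ i, α i =
      if l i < 0 then sSup ((fun x => (φ i x) ^ 2) '' Set.Icc (0 : ℝ) 1)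
      else if 0 < l i then
        sInf (φ i '' Set.Icc (0 : ℝ) 1) * sSup (φ i '' Set.Icc (0 : ℝ) 1)
      else 0)
    (hpos : 0 ≤ 1 + ∑ i, l i * α i) :
    ∀ u ∈ Set.Icc (0 : ℝ) 1, ∀ v ∈ Set.Icc (0 : ℝ) 1,
      0 ≤ 1 + ∑ i, l i * φ i u * φ i v := by
  intro u hu v hv
  have key : ∀ i, l i * α i ≤ l i * φ i u * φ i v := by
    intro i
    rw [mul_assoc]
    have hua := le_csSup (hbddA i) (Set.mem_image_of_mem (φ i) hu)
    have hva := le_csSup (hbddA i) (Set.mem_image_of_mem (φ i) hv)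
    have hub := csInf_le (hbddB i) (Set.mem_image_of_mem (φ i) hu)
    have hvb := csInf_le (hbddB i) (Set.mem_image_of_mem (φ i) hv)
    have hmi := hm i
    have hMi := hM i
    rw [hα i]
    split_ifs with h1 h2
    · apply mul_le_mul_of_nonpos_left _ h1.le
      have hb : BddAbove ((fun x => (φ i x) ^ 2) '' Set.Icc (0 : ℝ) 1) := by
        obtain ⟨A, hA⟩ := hbddA i
        obtain ⟨B, hB⟩ := hbddB i
        refine ⟨A ^ 2 + B ^ 2, ?_⟩
        rintro _ ⟨x, hx, rfl⟩
        have h3 := hA (Set.mem_image_of_mem (φ i) hx)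
        have h4 := hB (Set.mem_image_of_mem (φ i) hx)
        show (φ i x) ^ 2 ≤ A ^ 2 + B ^ 2
        rcases le_total 0 (φ i x) with h | h <;> nlinarith [sq_nonneg A, sq_nonneg B]
      have h3 := le_csSup hb (Set.mem_image_of_mem (fun x => (φ i x) ^ 2) hu)
      have h4 := le_csSup hb (Set.mem_image_of_mem (fun x => (φ i x) ^ 2) hv)
      nlinarith [sq_nonneg (φ i u - φ i v)]
    · apply mul_le_mul_of_nonneg_left _ h2.le
      generalize sInf (φ i '' Set.Icc (0 : ℝ) 1) = m at *
      generalize sSup (φ i '' Set.Icc (0 : ℝ) 1) = M at *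
      rcases le_total 0 (φ i u) with h | h
      · nlinarith [mul_le_mul_of_nonneg_left hvb h, mul_le_mul_of_nonpos_right hua hmi]
      · nlinarith [mul_le_mul_of_nonpos_left hva h, mul_le_mul_of_nonneg_right hub hMi]
    · have : l i = 0 := le_antisymm (not_lt.mp h2) (not_lt.mp h1)
      simp [this]
  have := Finset.sum_le_sum (fun i (_ : i ∈ Finset.univ) => key i)
  linarith
end

section
/- Let λ₁, λ₂ ∈ ℝ and let c(u,v) = 1 + 2λ₁ cos(πu)cos(πv) + 2λ₂ cos(2πu)cos(2πv) be the sine copula density. Then for all u, v ∈ [0,1], ∫₀¹ c(u,t)c(t,v) dt = 1 + 2λ₁² cos(πu)cos(πv) + 2λ₂² cos(2πu)cos(2πv). -/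
open Real

/-- The sine copula density with parameters `l1, l2`. -/
noncomputable def sineCopulaDensity (l1 l2 u v : ℝ) : ℝ :=
  1 + 2 * l1 * Real.cos (π * u) * Real.cos (π * v)
    + 2 * l2 * Real.cos (2 * π * u) * Real.cos (2 * π * v)

theorem helper_cos_int (k : ℕ) (hk : k ≠ 0) :
    ∫ t in (0 : ℝ)..1, Real.cos (k * π * t) = 0 := by
  have hkp : (k : ℝ) * π ≠ 0 := mul_ne_zero (by exact_mod_cast hk) Real.pi_ne_zero
  rw [intervalIntegral.integral_comp_mul_left (fun x => Real.cos x) hkp]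
  simp [Real.sin_nat_mul_pi]

theorem helper_int (c0 c1 c2 c3 c4 : ℝ) :
    ∫ t in (0 : ℝ)..1, (c0 + c1 * Real.cos ((1 : ℕ) * π * t) + c2 * Real.cos ((2 : ℕ) * π * t)
      + c3 * Real.cos ((3 : ℕ) * π * t) + c4 * Real.cos ((4 : ℕ) * π * t)) = c0 := by
  have hi : ∀ f : ℝ → ℝ, Continuous f → IntervalIntegrable f MeasureTheory.volume 0 1 :=
    fun f hf => hf.intervalIntegrable 0 1
  rw [intervalIntegral.integral_add (hi _ (by fun_prop)) (hi _ (by fun_prop)),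
    intervalIntegral.integral_add (hi _ (by fun_prop)) (hi _ (by fun_prop)),
    intervalIntegral.integral_add (hi _ (by fun_prop)) (hi _ (by fun_prop)),
    intervalIntegral.integral_add (hi _ (by fun_prop)) (hi _ (by fun_prop))]
  simp only [intervalIntegral.integral_const_mul]
  rw [helper_cos_int 1 (by norm_num), helper_cos_int 2 (by norm_num),
    helper_cos_int 3 (by norm_num), helper_cos_int 4 (by norm_num)]
  simp

theorem sineCopulaDensity_fold (l1 l2 : ℝ) :
    ∀ u ∈ Set.Icc (0 : ℝ) 1, ∀ v ∈ Set.Icc (0 : ℝ) 1,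
      ∫ t in (0 : ℝ)..1, sineCopulaDensity l1 l2 u t * sineCopulaDensity l1 l2 t v
        = 1 + 2 * l1 ^ 2 * Real.cos (π * u) * Real.cos (π * v)
          + 2 * l2 ^ 2 * Real.cos (2 * π * u) * Real.cos (2 * π * v) := by
  intro u _ v _
  generalize hA : Real.cos (π * u) = A
  generalize hB : Real.cos (2 * π * u) = B
  generalize hP : Real.cos (π * v) = P
  generalize hQ : Real.cos (2 * π * v) = Q
  rw [← helper_int (1 + 2 * l1 ^ 2 * A * P + 2 * l2 ^ 2 * B * Q)
    (2 * l1 * A + 2 * l1 * P + 2 * l1 * l2 * (A * Q + P * B))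
    (2 * l2 * (B + Q) + 2 * l1 ^ 2 * A * P)
    (2 * l1 * l2 * (A * Q + P * B)) (2 * l2 ^ 2 * B * Q)]
  congr 1
  funext t
  unfold sineCopulaDensity
  rw [hA, hB, hP, hQ]
  have h1 : ((1 : ℕ) : ℝ) * π * t = π * t := by push_cast; ring
  have h2 : ((2 : ℕ) : ℝ) * π * t = 2 * (π * t) := by push_cast; ring
  have h3 : ((3 : ℕ) : ℝ) * π * t = 3 * (π * t) := by push_cast; ring
  have h4 : ((4 : ℕ) : ℝ) * π * t = 2 * (2 * (π * t)) := by push_cast; ring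
  have h5 : 2 * π * t = 2 * (π * t) := by ring
  rw [h1, h2, h3, h4, h5, Real.cos_three_mul, Real.cos_two_mul (2 * (π * t)),
    Real.cos_two_mul (π * t)]
  ring
end

section
/- For N ∈ ℕ, let φ₁,…,φ_N : [0,1] → ℝ be continuous functions satisfying ∫₀¹ φᵢ(x) dx = 0 for all i and ∫₀¹ φᵢ(x)φⱼ(x) dx = δ_{ij} for all i,j, let λ₁,…,λ_N be real numbers, and define c(u,v) = 1 + Σ_{i=1}^N λᵢ φᵢ(u)φᵢ(v). For m ≥ 1 let c_m(u,v) = 1 + Σ_{z=1}^N λ_zᵐ φ_z(u)φ_z(v). Then for each k ∈ {1,…,N} and each m ≥ 1, ∫₀¹∫₀¹∫₀¹∫₀¹ φ_k(u₀)φ_k(u₁)φ_k(u₂)φ_k(u₃) c(u₀,u₁) c_m(u₁,u₂) c(u₂,u₃) du₀ du₁ du₂ du₃ = λ_k² (1 + Σ_{z=1}^N λ_zᵐ (∫₀¹ φ_z(x)φ_k(x)² dx)²). -/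
theorem lin_aux (N : ℕ) (φ : Fin N → ℝ → ℝ)
    (hcont : ∀ i, ContinuousOn (φ i) (Set.Icc (0 : ℝ) 1)) (g : ℝ → ℝ)
    (hg : ContinuousOn g (Set.Icc (0 : ℝ) 1)) (C : ℝ) (a : Fin N → ℝ) :
    ∫ u in (0 : ℝ)..1, g u * (C + ∑ z, a z * φ z u)
      = C * (∫ u in (0 : ℝ)..1, g u) + ∑ z, a z * ∫ u in (0 : ℝ)..1, φ z u * g u := by
  have hi : ∀ f : ℝ → ℝ, ContinuousOn f (Set.Icc (0 : ℝ) 1) →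
      IntervalIntegrable f MeasureTheory.volume 0 1 := fun f hf =>
    ContinuousOn.intervalIntegrable (by rwa [Set.uIcc_of_le zero_le_one])
  have h1 : ∀ u, g u * (C + ∑ z, a z * φ z u) = C * g u + ∑ z, a z * (φ z u * g u) := by
    intro u
    rw [mul_add, Finset.mul_sum, mul_comm]
    congr 1
    exact Finset.sum_congr rfl fun z _ => by ring
  have h2 : ∀ z, IntervalIntegrable (fun u => a z * (φ z u * g u)) MeasureTheory.volume 0 1 :=
    fun z => (hi _ ((hcont z).mul hg)).const_mul _
  simp_rw [h1]
  rw [intervalIntegral.integral_add ((hi g hg).const_mul C)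
    (hi (fun u => ∑ z, a z * (φ z u * g u)) (continuousOn_finsetSum _ fun z _ => continuousOn_const.mul ((hcont z).mul hg))),
    intervalIntegral.integral_finsetSum fun z _ => h2 z]
  simp

theorem fourth_moment_identity (N : ℕ) (φ : Fin N → ℝ → ℝ)
    (hcont : ∀ i, ContinuousOn (φ i) (Set.Icc (0 : ℝ) 1))
    (hmean : ∀ i, ∫ x in (0 : ℝ)..1, φ i x = 0)
    (horth : ∀ i j, ∫ x in (0 : ℝ)..1, φ i x * φ j x = if i = j then (1 : ℝ) else 0)
    (l : Fin N → ℝ)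
    (c : ℝ → ℝ → ℝ) (hc : ∀ u v, c u v = 1 + ∑ i, l i * φ i u * φ i v)
    (cm : ℕ → ℝ → ℝ → ℝ)
    (hcm : ∀ m, 1 ≤ m → ∀ u v, cm m u v = 1 + ∑ z, (l z) ^ m * φ z u * φ z v) :
    ∀ k : Fin N, ∀ m, 1 ≤ m →
      (∫ u0 in (0 : ℝ)..1, ∫ u1 in (0 : ℝ)..1, ∫ u2 in (0 : ℝ)..1, ∫ u3 in (0 : ℝ)..1,
          φ k u0 * φ k u1 * φ k u2 * φ k u3 * c u0 u1 * cm m u1 u2 * c u2 u3)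
        = (l k) ^ 2 * (1 + ∑ z, (l z) ^ m * (∫ x in (0 : ℝ)..1, φ z x * (φ k x) ^ 2) ^ 2) := by
  intro k m hm
  have hk := hcont k
  have hkk : ContinuousOn (fun u => φ k u * φ k u) (Set.Icc (0 : ℝ) 1) := hk.mul hk
  have L := lin_aux N φ hcont
  have hone : ∫ x in (0 : ℝ)..1, φ k x * φ k x = 1 := by simpa using horth k k
  have e3 : ∀ u0 u1 u2, (∫ u3 in (0 : ℝ)..1,
      φ k u0 * φ k u1 * φ k u2 * φ k u3 * c u0 u1 * cm m u1 u2 * c u2 u3)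
      = (φ k u0 * φ k u1 * c u0 u1 * l k) * ((φ k u2 * φ k u2) * cm m u1 u2) := by
    intro u0 u1 u2
    have h : ∀ u3, φ k u0 * φ k u1 * φ k u2 * φ k u3 * c u0 u1 * cm m u1 u2 * c u2 u3
        = (φ k u0 * φ k u1 * φ k u2 * c u0 u1 * cm m u1 u2) *
          (φ k u3 * (1 + ∑ z, (l z * φ z u2) * φ z u3)) := by
      intro u3; rw [hc u2 u3]; ring
    simp_rw [h]
    rw [intervalIntegral.integral_const_mul, L _ hk, hmean]
    simp [horth]
    ring
  set I : Fin N → ℝ := fun z => ∫ x in (0 : ℝ)..1, φ z x * (φ k x * φ k x) with hI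
  set h : ℝ → ℝ := fun u => 1 + ∑ z, (l z ^ m * I z) * φ z u with hh
  have hhc : ContinuousOn h (Set.Icc (0 : ℝ) 1) :=
    continuousOn_const.add (continuousOn_finsetSum _ fun z _ => continuousOn_const.mul (hcont z))
  have e2 : ∀ u1, (∫ u2 in (0 : ℝ)..1, (φ k u2 * φ k u2) * cm m u1 u2) = h u1 := by
    intro u1
    simp_rw [hcm m hm]
    rw [L _ hkk, hone, hh]
    simp only [mul_one]
    congr 1
    exact Finset.sum_congr rfl fun z _ => by simp only [hI]; ring
  have e1 : ∀ u0, (∫ u1 in (0 : ℝ)..1, φ k u0 * φ k u1 * c u0 u1 * l k * h u1)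
      = l k * (φ k u0 * ((∫ u in (0 : ℝ)..1, φ k u * h u)
        + ∑ z, (l z * ∫ u in (0 : ℝ)..1, φ z u * (φ k u * h u)) * φ z u0)) := by
    intro u0
    have h' : ∀ u1, φ k u0 * φ k u1 * c u0 u1 * l k * h u1
        = (l k * φ k u0) * ((φ k u1 * h u1) * (1 + ∑ z, (l z * φ z u0) * φ z u1)) := by
      intro u1; rw [hc u0 u1]; ring
    simp_rw [h']
    rw [intervalIntegral.integral_const_mul, L (fun u => φ k u * h u) (hk.mul hhc), mul_assoc, one_mul]
    congr 3
    exact Finset.sum_congr rfl fun z _ => by ring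
  have e0 : (∫ u in (0 : ℝ)..1, φ k u * (φ k u * h u)) = 1 + ∑ z, l z ^ m * I z ^ 2 := by
    simp_rw [← mul_assoc]
    rw [hh, L _ hkk, hone, one_mul]
    congr 1
    exact Finset.sum_congr rfl fun z _ => by simp only [hI]; ring
  simp_rw [e3, intervalIntegral.integral_const_mul, e2, e1, intervalIntegral.integral_const_mul]
  rw [L _ hk, hmean]
  simp only [horth, mul_ite, mul_one, mul_zero, Finset.sum_ite_eq', Finset.mem_univ, if_true,
    zero_add]
  rw [e0]
  simp only [hI, pow_two]
  ring
end

section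
/- Let λ₁, λ₂ ∈ ℝ with |λ₁| < 1 and |λ₂| < 1, and let φ₁(x) = √2 cos(πx), φ₂(x) = √2 cos(2πx). Then 1 − λ₁² + λ₁(∫₀¹ φ₁(x)³ dx)² + λ₂(∫₀¹ φ₂(x)φ₁(x)² dx)² + 2λ₁²(∫₀¹ φ₁(x)⁴ dx − 1) + 2λ₁² Σ_{m=2}^∞ (λ₁^{m−1}(∫₀¹ φ₁(x)³ dx)² + λ₂^{m−1}(∫₀¹ φ₂(x)φ₁(x)² dx)²) = 1 + λ₂/2 + λ₁²λ₂/(1−λ₂). -/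
open Real

/-- First orthonormal cosine function `φ₁(x) = √2 cos(πx)`. -/
noncomputable def sinePhi1 (x : ℝ) : ℝ := Real.sqrt 2 * Real.cos (π * x)

/-- Second orthonormal cosine function `φ₂(x) = √2 cos(2πx)`. -/
noncomputable def sinePhi2 (x : ℝ) : ℝ := Real.sqrt 2 * Real.cos (2 * π * x)

lemma int_cos_aux (k : ℕ) (hk : k ≠ 0) : ∫ x in (0 : ℝ)..1, Real.cos ((k * π) * x) = 0 := by
  have h : (k * π : ℝ) ≠ 0 := mul_ne_zero (by exact_mod_cast hk) Real.pi_ne_zero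
  rw [intervalIntegral.integral_comp_mul_left (fun y => Real.cos y) h]
  simp [Real.sin_nat_mul_pi]

lemma int_comb_aux (a b c : ℝ) (j k : ℕ) (hj : j ≠ 0) (hk : k ≠ 0) :
    ∫ x in (0 : ℝ)..1, (a + b * Real.cos ((j * π) * x) + c * Real.cos ((k * π) * x)) = a := by
  rw [intervalIntegral.integral_add, intervalIntegral.integral_add,
    intervalIntegral.integral_const_mul, intervalIntegral.integral_const_mul,
    int_cos_aux j hj, int_cos_aux k hk]
  · simp
  all_goals exact Continuous.intervalIntegrable (by fun_prop) _ _

lemma cos_four_aux (x : ℝ) : Real.cos (((4 : ℕ) * π) * x) = 2 * Real.cos (2 * π * x) ^ 2 - 1 := by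
  rw [← Real.cos_two_mul]; congr 1; push_cast; ring

lemma cos_two_aux (x : ℝ) : Real.cos (2 * π * x) = 2 * Real.cos (π * x) ^ 2 - 1 := by
  rw [← Real.cos_two_mul]; congr 1; ring

lemma cos_three_aux (x : ℝ) :
    Real.cos (((3 : ℕ) * π) * x) = 4 * Real.cos (π * x) ^ 3 - 3 * Real.cos (π * x) := by
  rw [← Real.cos_three_mul]; congr 1; push_cast; ring

lemma sqrt_two_aux : Real.sqrt 2 ^ 2 = 2 := Real.sq_sqrt (by norm_num)

lemma int_one_aux : ∫ x in (0 : ℝ)..1, (sinePhi1 x) ^ 3 = 0 := by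
  refine Eq.trans ?_ (int_comb_aux 0 (3 * Real.sqrt 2 / 2) (Real.sqrt 2 / 2) 1 3 (by norm_num) (by norm_num))
  congr 1; ext x
  rw [cos_three_aux, sinePhi1, Nat.cast_one, one_mul]
  linear_combination Real.sqrt 2 * Real.cos (π * x) ^ 3 * sqrt_two_aux

lemma int_two_aux : ∫ x in (0 : ℝ)..1, sinePhi2 x * (sinePhi1 x) ^ 2 = Real.sqrt 2 / 2 := by
  rw [← int_comb_aux (Real.sqrt 2 / 2) (Real.sqrt 2) (Real.sqrt 2 / 2) 2 4
    (by norm_num) (by norm_num)]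
  congr 1; ext x
  rw [cos_four_aux, sinePhi1, sinePhi2, Nat.cast_ofNat, cos_two_aux]
  linear_combination Real.sqrt 2 * (2 * Real.cos (π * x) ^ 2 - 1) * Real.cos (π * x) ^ 2
    * sqrt_two_aux

lemma int_three_aux : ∫ x in (0 : ℝ)..1, (sinePhi1 x) ^ 4 = 3 / 2 := by
  rw [← int_comb_aux (3 / 2) 2 (1 / 2) 2 4 (by norm_num) (by norm_num)]
  congr 1; ext x
  rw [cos_four_aux, sinePhi1, Nat.cast_ofNat, cos_two_aux]
  linear_combination Real.cos (π * x) ^ 4 * (Real.sqrt 2 ^ 2 + 2) * sqrt_two_aux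

theorem sine_variance_entry (l1 l2 : ℝ) (h1 : |l1| < 1) (h2 : |l2| < 1) :
    1 - l1 ^ 2 + l1 * (∫ x in (0 : ℝ)..1, (sinePhi1 x) ^ 3) ^ 2
      + l2 * (∫ x in (0 : ℝ)..1, sinePhi2 x * (sinePhi1 x) ^ 2) ^ 2
      + 2 * l1 ^ 2 * ((∫ x in (0 : ℝ)..1, (sinePhi1 x) ^ 4) - 1)
      + 2 * l1 ^ 2 * ∑' m : ℕ,
          (l1 ^ (m + 1) * (∫ x in (0 : ℝ)..1, (sinePhi1 x) ^ 3) ^ 2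
            + l2 ^ (m + 1) * (∫ x in (0 : ℝ)..1, sinePhi2 x * (sinePhi1 x) ^ 2) ^ 2)
      = 1 + l2 / 2 + l1 ^ 2 * l2 / (1 - l2) := by
  have hl : 1 - l2 ≠ 0 := by
    have := (abs_lt.mp h2).2
    linarith
  have hs : (Real.sqrt 2 / 2) ^ 2 = 1 / 2 := by
    rw [div_pow, sqrt_two_aux]; norm_num
  have ht : ∑' m : ℕ, (l1 ^ (m + 1) * (0 : ℝ) ^ 2 + l2 ^ (m + 1) * (1 / 2))
      = l2 / 2 * (1 - l2)⁻¹ := by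
    rw [← tsum_geometric_of_abs_lt_one h2, ← tsum_mul_left]
    congr 1; ext m; ring
  rw [int_one_aux, int_two_aux, int_three_aux, hs, ht]
  field_simp
  ring
end

section
/- Let λ₁, λ₂ ∈ ℝ with |λ₁| < 1 and |λ₂| < 1, and let φ₁(x) = √2 cos(πx), φ₂(x) = √2 cos(2πx). Then Σ_{z=1}^2 λ_z (∫₀¹ φ_z(x)φ₁(x)φ₂(x) dx)² + λ₁λ₂ (2(∫₀¹ φ₁(x)²φ₂(x)² dx − 1) + 2 Σ_{m=2}^∞ Σ_{z=1}^2 λ_z^{m−1} (∫₀¹ φ_z(x)φ₁(x)² dx)(∫₀¹ φ_z(x)φ₂(x)² dx) − 1) = λ₁(1/2 − λ₂). -/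
open Real

lemma aux_cos_int (k : ℕ) (hk : k ≠ 0) : ∫ x in (0 : ℝ)..1, Real.cos (k * π * x) = 0 := by
  have h : (k * π : ℝ) ≠ 0 := mul_ne_zero (by exact_mod_cast hk) Real.pi_ne_zero
  rw [intervalIntegral.integral_comp_mul_left (fun y => Real.cos y) h]
  simp [Real.sin_nat_mul_pi]

/-- The constant coefficient of a trigonometric polynomial is its mean. -/
lemma aux_trig_int (f : ℝ → ℝ) (a : ℝ) (b : ℕ → ℝ)
    (hf : ∀ x, f x = a + ∑ k ∈ Finset.range 6, b k * Real.cos ((k + 1 : ℕ) * π * x)) :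
    ∫ x in (0 : ℝ)..1, f x = a := by
  simp_rw [hf]
  rw [intervalIntegral.integral_add (by simp)
    (Continuous.intervalIntegrable (by fun_prop) _ _),
    intervalIntegral.integral_finsetSum
      (fun i _ => Continuous.intervalIntegrable (by fun_prop) _ _)]
  simp_rw [intervalIntegral.integral_const_mul]
  rw [Finset.sum_eq_zero (fun i _ => by rw [aux_cos_int _ (Nat.succ_ne_zero i), mul_zero])]
  simp

lemma aux_trig_int6 (f : ℝ → ℝ) (a b1 b2 b3 b4 b5 b6 : ℝ)
    (hf : ∀ x, ∀ c s : ℝ, c = Real.cos (π * x) → s = Real.sqrt 2 → s ^ 2 = 2 →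
      sinePhi1 x = s * c → sinePhi2 x = s * (2 * c ^ 2 - 1) →
      f x = a + b1 * c + b2 * (2 * c ^ 2 - 1) + b3 * (4 * c ^ 3 - 3 * c)
        + b4 * (8 * c ^ 4 - 8 * c ^ 2 + 1) + b5 * (16 * c ^ 5 - 20 * c ^ 3 + 5 * c)
        + b6 * (32 * c ^ 6 - 48 * c ^ 4 + 18 * c ^ 2 - 1)) :
    ∫ x in (0 : ℝ)..1, f x = a := by
  apply aux_trig_int f a (fun k => if k = 0 then b1 else if k = 1 then b2 else if k = 2 then b3
    else if k = 3 then b4 else if k = 4 then b5 else b6)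
  intro x
  have e2 : Real.cos (2 * π * x) = 2 * Real.cos (π * x) ^ 2 - 1 := by
    rw [← Real.cos_two_mul]; ring_nf
  have e3 : Real.cos (3 * π * x) = 4 * Real.cos (π * x) ^ 3 - 3 * Real.cos (π * x) := by
    rw [← Real.cos_three_mul]; ring_nf
  have e4 : Real.cos (4 * π * x) = 2 * Real.cos (2 * π * x) ^ 2 - 1 := by
    rw [← Real.cos_two_mul]; ring_nf
  have e6 : Real.cos (6 * π * x) = 2 * Real.cos (3 * π * x) ^ 2 - 1 := by
    rw [← Real.cos_two_mul]; ring_nf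
  have e5 : Real.cos (5 * π * x)
      = 2 * Real.cos (3 * π * x) * Real.cos (2 * π * x) - Real.cos (π * x) := by
    have p := Real.cos_add (3 * π * x) (2 * π * x)
    have m := Real.cos_sub (3 * π * x) (2 * π * x)
    rw [show 3 * π * x + 2 * π * x = 5 * π * x by ring] at p
    rw [show 3 * π * x - 2 * π * x = π * x by ring] at m
    linarith
  rw [hf x (Real.cos (π * x)) (Real.sqrt 2) rfl rfl (Real.sq_sqrt (by norm_num)) rfl
    (by rw [sinePhi2, e2])]
  simp only [Finset.sum_range_succ, Finset.sum_range_zero]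
  norm_num
  rw [e6, e5, e4, e3, e2]
  ring

theorem sine_covariance_entry (l1 l2 : ℝ) (h1 : |l1| < 1) (h2 : |l2| < 1) :
    (∑ z : Fin 2, ![l1, l2] z
        * (∫ x in (0 : ℝ)..1, ![sinePhi1, sinePhi2] z x * sinePhi1 x * sinePhi2 x) ^ 2)
      + l1 * l2 * (2 * ((∫ x in (0 : ℝ)..1, (sinePhi1 x) ^ 2 * (sinePhi2 x) ^ 2) - 1)
        + 2 * ∑' m : ℕ, ∑ z : Fin 2, (![l1, l2] z) ^ (m + 1)
            * (∫ x in (0 : ℝ)..1, ![sinePhi1, sinePhi2] z x * (sinePhi1 x) ^ 2)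
            * (∫ x in (0 : ℝ)..1, ![sinePhi1, sinePhi2] z x * (sinePhi2 x) ^ 2)
        - 1)
      = l1 * (1 / 2 - l2) := by
  have I1 : ∫ x in (0 : ℝ)..1, sinePhi1 x * sinePhi1 x * sinePhi2 x = Real.sqrt 2 / 2 := by
    apply aux_trig_int6 _ _ 0 (Real.sqrt 2) 0 (Real.sqrt 2 / 2) 0 0
    intro x c s hc hs h e1 e2
    rw [e1, e2, ← hs]
    linear_combination (s * c ^ 2 * (2 * c ^ 2 - 1)) * h
  have I2 : ∫ x in (0 : ℝ)..1, sinePhi2 x * sinePhi1 x * sinePhi2 x = 0 := by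
    apply aux_trig_int6 _ _ (Real.sqrt 2) 0 (Real.sqrt 2 / 2) 0 (Real.sqrt 2 / 2) 0
    intro x c s hc hs h e1 e2
    rw [e1, e2, ← hs]
    linear_combination (s * c * (2 * c ^ 2 - 1) ^ 2) * h
  have I3 : ∫ x in (0 : ℝ)..1, (sinePhi1 x) ^ 2 * (sinePhi2 x) ^ 2 = 1 := by
    apply aux_trig_int6 _ _ 0 (3 / 2) 0 1 0 (1 / 2)
    intro x c s hc hs h e1 e2
    rw [e1, e2]
    linear_combination (c ^ 2 * (2 * c ^ 2 - 1) ^ 2 * (s ^ 2 + 2)) * h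
  have I4 : ∫ x in (0 : ℝ)..1, sinePhi1 x * (sinePhi1 x) ^ 2 = 0 := by
    apply aux_trig_int6 _ _ (3 * Real.sqrt 2 / 2) 0 (Real.sqrt 2 / 2) 0 0 0
    intro x c s hc hs h e1 e2
    rw [e1, ← hs]
    linear_combination (s * c ^ 3) * h
  have I5 : ∫ x in (0 : ℝ)..1, sinePhi2 x * (sinePhi2 x) ^ 2 = 0 := by
    apply aux_trig_int6 _ _ 0 (3 * Real.sqrt 2 / 2) 0 0 0 (Real.sqrt 2 / 2)
    intro x c s hc hs h e1 e2
    rw [e2, ← hs]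
    linear_combination (s * (2 * c ^ 2 - 1) ^ 3) * h
  have hs : Real.sqrt 2 ^ 2 = 2 := Real.sq_sqrt (by norm_num)
  simp only [Fin.sum_univ_two, Matrix.cons_val_zero, Matrix.cons_val_one, I1, I2, I3, I4, I5,
    mul_zero, zero_mul, add_zero, tsum_zero]
  linear_combination (l1 / 4) * hs
end

section
/- Let λ₁, λ₂ ∈ ℝ with |λ₁| < 1 and |λ₂| < 1, and let φ₁(x) = √3(2x−1), φ₂(x) = √5(6x²−6x+1). Then 1 − λ₁² + λ₁(∫₀¹ φ₁(x)³ dx)² + λ₂(∫₀¹ φ₂(x)φ₁(x)² dx)² + 2λ₁²(∫₀¹ φ₁(x)⁴ dx − 1) + 2λ₁² Σ_{m=2}^∞ (λ₁^{m−1}(∫₀¹ φ₁(x)³ dx)² + λ₂^{m−1}(∫₀¹ φ₂(x)φ₁(x)² dx)²) = 1 + (4/5)λ₂ + λ₁²(3 + 5λ₂)/(5(1−λ₂)). -/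
/-- First shifted Legendre polynomial `φ₁(x) = √3(2x−1)`. -/
noncomputable def legPhi1 (x : ℝ) : ℝ := Real.sqrt 3 * (2 * x - 1)

/-- Second shifted Legendre polynomial `φ₂(x) = √5(6x²−6x+1)`. -/
noncomputable def legPhi2 (x : ℝ) : ℝ := Real.sqrt 5 * (6 * x ^ 2 - 6 * x + 1)

theorem leg_int_three : (∫ x in (0 : ℝ)..1, (legPhi1 x) ^ 3) = 0 := by
  have hd : ∀ x ∈ Set.uIcc (0 : ℝ) 1,
      HasDerivAt (fun y : ℝ => Real.sqrt 3 ^ 3 * (2 * y ^ 4 - 4 * y ^ 3 + 3 * y ^ 2 - y))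
        ((legPhi1 x) ^ 3) x := by
    intro x _
    have h := (((((hasDerivAt_pow 4 x).const_mul 2).sub ((hasDerivAt_pow 3 x).const_mul 4)).add
      ((hasDerivAt_pow 2 x).const_mul 3)).sub (hasDerivAt_id x)).const_mul (Real.sqrt 3 ^ 3)
    refine h.congr_deriv ?_
    unfold legPhi1
    norm_num
    ring
  rw [intervalIntegral.integral_eq_sub_of_hasDerivAt hd
    (Continuous.intervalIntegrable (by unfold legPhi1; fun_prop) _ _)]
  norm_num

theorem leg_int_four : (∫ x in (0 : ℝ)..1, (legPhi1 x) ^ 4) = 9 / 5 := by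
  have hs : Real.sqrt 3 ^ 4 = 9 := by
    have h : Real.sqrt 3 ^ 2 = 3 := Real.sq_sqrt (by norm_num)
    calc Real.sqrt 3 ^ 4 = (Real.sqrt 3 ^ 2) ^ 2 := by ring
      _ = 9 := by rw [h]; norm_num
  have hd : ∀ x ∈ Set.uIcc (0 : ℝ) 1,
      HasDerivAt (fun y : ℝ => (9 / 10) * (2 * y - 1) ^ 5) ((legPhi1 x) ^ 4) x := by
    intro x _
    have h := (((((hasDerivAt_id x).const_mul 2).sub_const 1).pow 5).const_mul (9 / 10 : ℝ))
    refine h.congr_deriv ?_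
    unfold legPhi1
    rw [mul_pow, hs]
    norm_num
    ring
  rw [intervalIntegral.integral_eq_sub_of_hasDerivAt hd
    (Continuous.intervalIntegrable (by unfold legPhi1; fun_prop) _ _)]
  norm_num

theorem leg_int_mixed :
    (∫ x in (0 : ℝ)..1, legPhi2 x * (legPhi1 x) ^ 2) = Real.sqrt 5 * (2 / 5) := by
  have hs : Real.sqrt 3 ^ 2 = 3 := Real.sq_sqrt (by norm_num)
  have hd : ∀ x ∈ Set.uIcc (0 : ℝ) 1,
      HasDerivAt (fun y : ℝ => Real.sqrt 5 * ((9 / 20) * (2 * y - 1) ^ 5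
        - (1 / 4) * (2 * y - 1) ^ 3)) (legPhi2 x * (legPhi1 x) ^ 2) x := by
    intro x _
    have h0 := ((hasDerivAt_id x).const_mul 2).sub_const 1
    have h := (((h0.pow 5).const_mul (9 / 20 : ℝ)).sub
      ((h0.pow 3).const_mul (1 / 4 : ℝ))).const_mul (Real.sqrt 5)
    refine h.congr_deriv ?_
    unfold legPhi1 legPhi2
    rw [mul_pow, hs]
    norm_num
    ring
  rw [intervalIntegral.integral_eq_sub_of_hasDerivAt hd
    (Continuous.intervalIntegrable (by unfold legPhi1 legPhi2; fun_prop) _ _)]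
  ring

theorem legendre_variance_entry_one (l1 l2 : ℝ) (h1 : |l1| < 1) (h2 : |l2| < 1) :
    1 - l1 ^ 2 + l1 * (∫ x in (0 : ℝ)..1, (legPhi1 x) ^ 3) ^ 2
      + l2 * (∫ x in (0 : ℝ)..1, legPhi2 x * (legPhi1 x) ^ 2) ^ 2
      + 2 * l1 ^ 2 * ((∫ x in (0 : ℝ)..1, (legPhi1 x) ^ 4) - 1)
      + 2 * l1 ^ 2 * ∑' m : ℕ,
          (l1 ^ (m + 1) * (∫ x in (0 : ℝ)..1, (legPhi1 x) ^ 3) ^ 2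
            + l2 ^ (m + 1) * (∫ x in (0 : ℝ)..1, legPhi2 x * (legPhi1 x) ^ 2) ^ 2)
      = 1 + (4 / 5) * l2 + l1 ^ 2 * (3 + 5 * l2) / (5 * (1 - l2)) := by
  have h5 : (Real.sqrt 5 * (2 / 5)) ^ 2 = 4 / 5 := by
    rw [mul_pow, Real.sq_sqrt (by norm_num)]; norm_num
  have hne : (1 : ℝ) - l2 ≠ 0 := by
    have := (abs_lt.mp h2).2
    linarith
  rw [leg_int_three, leg_int_four, leg_int_mixed, h5]
  have hsum : ∑' m : ℕ, (l1 ^ (m + 1) * (0 : ℝ) ^ 2 + l2 ^ (m + 1) * (4 / 5))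
      = (1 - l2)⁻¹ * (l2 * (4 / 5)) := by
    rw [← tsum_geometric_of_abs_lt_one h2, ← tsum_mul_right]
    congr 1
    ext m
    ring
  rw [hsum]
  field_simp
  ring
end

section
/- Let λ₁, λ₂ ∈ ℝ with |λ₁| < 1 and |λ₂| < 1, and let φ₁(x) = √3(2x−1), φ₂(x) = √5(6x²−6x+1). Then 1 − λ₂² + λ₁(∫₀¹ φ₁(x)φ₂(x)² dx)² + λ₂(∫₀¹ φ₂(x)³ dx)² + 2λ₂²(∫₀¹ φ₂(x)⁴ dx − 1) + 2λ₂² Σ_{m=2}^∞ (λ₁^{m−1}(∫₀¹ φ₁(x)φ₂(x)² dx)² + λ₂^{m−1}(∫₀¹ φ₂(x)³ dx)²) = 1 + (20/49)λ₂ + λ₂²(63 − 23λ₂)/(49(1−λ₂)). -/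
lemma hasDerivAt_lin_pow (n : ℕ) (x : ℝ) :
    HasDerivAt (fun x : ℝ => (2 * x - 1) ^ n) (n * (2 * x - 1) ^ (n - 1) * 2) x := by
  have h : HasDerivAt (fun x : ℝ => 2 * x - 1) 2 x := by
    simpa using ((hasDerivAt_id x).const_mul (2 : ℝ)).sub_const 1
  exact h.fun_pow n

lemma integral_of_antideriv (F f : ℝ → ℝ) (hf : Continuous f) (h : ∀ x, HasDerivAt F (f x) x) :
    ∫ x in (0 : ℝ)..1, f x = F 1 - F 0 :=
  intervalIntegral.integral_eq_sub_of_hasDerivAt (fun x _ => h x) (hf.intervalIntegrable _ _)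

lemma sq5 : Real.sqrt 5 ^ 2 = 5 := Real.sq_sqrt (by norm_num)

lemma int_a : ∫ x in (0 : ℝ)..1, legPhi1 x * (legPhi2 x) ^ 2 = 0 := by
  unfold legPhi1 legPhi2
  rw [integral_of_antideriv (fun x => Real.sqrt 3 * Real.sqrt 5 ^ 2 *
    ((9 / 6 * (2 * x - 1) ^ 6 - 6 / 4 * (2 * x - 1) ^ 4 + 1 / 2 * (2 * x - 1) ^ 2) / 8)) _
    (by fun_prop)]
  · norm_num
  · intro x
    refine ((((((hasDerivAt_lin_pow 6 x).const_mul (9 / 6)).sub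
      ((hasDerivAt_lin_pow 4 x).const_mul (6 / 4))).add
      ((hasDerivAt_lin_pow 2 x).const_mul (1 / 2))).div_const 8).const_mul
      (Real.sqrt 3 * Real.sqrt 5 ^ 2)).congr_deriv ?_
    push_cast
    ring

lemma int_b : ∫ x in (0 : ℝ)..1, (legPhi2 x) ^ 3 = Real.sqrt 5 ^ 3 * (2 / 35) := by
  unfold legPhi2
  rw [integral_of_antideriv (fun x => Real.sqrt 5 ^ 3 *
    ((27 / 7 * (2 * x - 1) ^ 7 - 27 / 5 * (2 * x - 1) ^ 5 + 3 * (2 * x - 1) ^ 3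
      - 1 * (2 * x - 1) ^ 1) / 16)) _ (by fun_prop)]
  · ring
  · intro x
    refine (((((((hasDerivAt_lin_pow 7 x).const_mul (27 / 7)).sub
      ((hasDerivAt_lin_pow 5 x).const_mul (27 / 5))).add
      ((hasDerivAt_lin_pow 3 x).const_mul 3)).sub
      ((hasDerivAt_lin_pow 1 x).const_mul 1)).div_const 16).const_mul
      (Real.sqrt 5 ^ 3)).congr_deriv ?_
    norm_num
    ring

lemma int_c : ∫ x in (0 : ℝ)..1, (legPhi2 x) ^ 4 = 15 / 7 := by
  have h5 : Real.sqrt 5 ^ 4 = 25 := by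
    rw [show Real.sqrt 5 ^ 4 = (Real.sqrt 5 ^ 2) ^ 2 by ring, sq5]; norm_num
  unfold legPhi2
  rw [integral_of_antideriv (fun x => Real.sqrt 5 ^ 4 *
    ((9 * (2 * x - 1) ^ 9 - 108 / 7 * (2 * x - 1) ^ 7 + 54 / 5 * (2 * x - 1) ^ 5
      - 4 * (2 * x - 1) ^ 3 + 1 * (2 * x - 1) ^ 1) / 32)) _ (by fun_prop)]
  · rw [h5]; norm_num
  · intro x
    refine ((((((((hasDerivAt_lin_pow 9 x).const_mul 9).sub
      ((hasDerivAt_lin_pow 7 x).const_mul (108 / 7))).add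
      ((hasDerivAt_lin_pow 5 x).const_mul (54 / 5))).sub
      ((hasDerivAt_lin_pow 3 x).const_mul 4)).add
      ((hasDerivAt_lin_pow 1 x).const_mul 1)).div_const 32).const_mul
      (Real.sqrt 5 ^ 4)).congr_deriv ?_
    norm_num
    ring

theorem legendre_variance_entry_two (l1 l2 : ℝ) (h1 : |l1| < 1) (h2 : |l2| < 1) :
    1 - l2 ^ 2 + l1 * (∫ x in (0 : ℝ)..1, legPhi1 x * (legPhi2 x) ^ 2) ^ 2
      + l2 * (∫ x in (0 : ℝ)..1, (legPhi2 x) ^ 3) ^ 2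
      + 2 * l2 ^ 2 * ((∫ x in (0 : ℝ)..1, (legPhi2 x) ^ 4) - 1)
      + 2 * l2 ^ 2 * ∑' m : ℕ,
          (l1 ^ (m + 1) * (∫ x in (0 : ℝ)..1, legPhi1 x * (legPhi2 x) ^ 2) ^ 2
            + l2 ^ (m + 1) * (∫ x in (0 : ℝ)..1, (legPhi2 x) ^ 3) ^ 2)
      = 1 + (20 / 49) * l2 + l2 ^ 2 * (63 - 23 * l2) / (49 * (1 - l2)) := by
  have hb : (Real.sqrt 5 ^ 3 * (2 / 35)) ^ 2 = (20 / 49 : ℝ) := by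
    rw [show (Real.sqrt 5 ^ 3 * (2 / 35)) ^ 2 = (Real.sqrt 5 ^ 2) ^ 3 * (2 / 35) ^ 2 by ring, sq5]
    norm_num
  have hne : 1 - l2 ≠ 0 := by
    have := (abs_lt.mp h2).2
    linarith
  have hs : ∑' m : ℕ, (l1 ^ (m + 1) * (0 : ℝ) ^ 2 + l2 ^ (m + 1) * (20 / 49)) =
      (1 - l2)⁻¹ * (l2 * (20 / 49)) := by
    rw [← tsum_geometric_of_abs_lt_one h2, ← tsum_mul_right]
    refine tsum_congr fun m => ?_
    ring
  rw [int_a, int_b, int_c, hb, hs]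
  field_simp
  ring
end

section
/- Let λ₁, λ₂ ∈ ℝ with |λ₁| < 1 and |λ₂| < 1, and let φ₁(x) = √3(2x−1), φ₂(x) = √5(6x²−6x+1). Then Σ_{z=1}^2 λ_z (∫₀¹ φ_z(x)φ₁(x)φ₂(x) dx)² + λ₁λ₂ (2(∫₀¹ φ₁(x)²φ₂(x)² dx − 1) + 2 Σ_{m=2}^∞ Σ_{z=1}^2 λ_z^{m−1} (∫₀¹ φ_z(x)φ₁(x)² dx)(∫₀¹ φ_z(x)φ₂(x)² dx) − 1) = (4/5)λ₁ + λ₁λ₂(1 + 7λ₂)/(7(1−λ₂)). -/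
theorem leg_poly_integral (f : ℝ → ℝ) (k a0 a1 a2 a3 a4 a5 a6 : ℝ)
    (hf : ∀ x, f x = k * (a0 + a1 * x + a2 * x ^ 2 + a3 * x ^ 3 + a4 * x ^ 4 + a5 * x ^ 5
      + a6 * x ^ 6)) :
    ∫ x in (0 : ℝ)..1, f x
      = k * (a0 + a1 / 2 + a2 / 3 + a3 / 4 + a4 / 5 + a5 / 6 + a6 / 7) := by
  have hd : ∀ x ∈ Set.uIcc (0 : ℝ) 1, HasDerivAt (fun x : ℝ => k * (a0 * x + a1 / 2 * x ^ 2
      + a2 / 3 * x ^ 3 + a3 / 4 * x ^ 4 + a4 / 5 * x ^ 5 + a5 / 6 * x ^ 6 + a6 / 7 * x ^ 7))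
      (f x) x := by
    intro x _
    have h := ((((((((hasDerivAt_id x).const_mul a0).add
      ((hasDerivAt_pow 2 x).const_mul (a1 / 2))).add
      ((hasDerivAt_pow 3 x).const_mul (a2 / 3))).add
      ((hasDerivAt_pow 4 x).const_mul (a3 / 4))).add
      ((hasDerivAt_pow 5 x).const_mul (a4 / 5))).add
      ((hasDerivAt_pow 6 x).const_mul (a5 / 6))).add
      ((hasDerivAt_pow 7 x).const_mul (a6 / 7))).const_mul k
    refine h.congr_deriv ?_
    rw [hf]
    push_cast
    ring
  have hc : Continuous f := by
    rw [funext hf]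
    fun_prop
  rw [intervalIntegral.integral_eq_sub_of_hasDerivAt hd (hc.intervalIntegrable 0 1)]
  ring

theorem legendre_covariance_entry (l1 l2 : ℝ) (h1 : |l1| < 1) (h2 : |l2| < 1) :
    (∑ z : Fin 2, ![l1, l2] z
        * (∫ x in (0 : ℝ)..1, ![legPhi1, legPhi2] z x * legPhi1 x * legPhi2 x) ^ 2)
      + l1 * l2 * (2 * ((∫ x in (0 : ℝ)..1, (legPhi1 x) ^ 2 * (legPhi2 x) ^ 2) - 1)
        + 2 * ∑' m : ℕ, ∑ z : Fin 2, (![l1, l2] z) ^ (m + 1)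
            * (∫ x in (0 : ℝ)..1, ![legPhi1, legPhi2] z x * (legPhi1 x) ^ 2)
            * (∫ x in (0 : ℝ)..1, ![legPhi1, legPhi2] z x * (legPhi2 x) ^ 2)
        - 1)
      = (4 / 5) * l1 + l1 * l2 * (1 + 7 * l2) / (7 * (1 - l2)) := by
  have s3 : Real.sqrt 3 ^ 2 = 3 := Real.sq_sqrt (by norm_num)
  have s5 : Real.sqrt 5 ^ 2 = 5 := Real.sq_sqrt (by norm_num)
  have i1 : ∫ x in (0 : ℝ)..1, legPhi1 x * legPhi1 x * legPhi2 x = 2 / 5 * Real.sqrt 5 := by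
    rw [leg_poly_integral _ (Real.sqrt 3 ^ 2 * Real.sqrt 5) 1 (-10) 34 (-48) 24 0 0
      (fun x => by simp only [legPhi1, legPhi2]; ring), s3]
    ring
  have i2 : ∫ x in (0 : ℝ)..1, legPhi2 x * legPhi1 x * legPhi2 x = 0 := by
    rw [leg_poly_integral _ (Real.sqrt 3 * Real.sqrt 5 ^ 2) (-1) 14 (-72) 168 (-180) 72 0
      (fun x => by simp only [legPhi1, legPhi2]; ring)]
    ring
  have i3 : ∫ x in (0 : ℝ)..1, (legPhi1 x) ^ 2 * (legPhi2 x) ^ 2 = 11 / 7 := by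
    rw [leg_poly_integral _ (Real.sqrt 3 ^ 2 * Real.sqrt 5 ^ 2) 1 (-16) 100 (-312) 516 (-432) 144
      (fun x => by simp only [legPhi1, legPhi2]; ring), s3, s5]
    norm_num
  have i4 : ∫ x in (0 : ℝ)..1, legPhi1 x * (legPhi1 x) ^ 2 = 0 := by
    rw [leg_poly_integral _ (Real.sqrt 3 ^ 3) (-1) 6 (-12) 8 0 0 0
      (fun x => by simp only [legPhi1]; ring)]
    ring
  have i5 : ∫ x in (0 : ℝ)..1, legPhi2 x * (legPhi1 x) ^ 2 = 2 / 5 * Real.sqrt 5 := by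
    rw [← i1]
    congr 1
    funext x
    ring
  have i6 : ∫ x in (0 : ℝ)..1, legPhi2 x * (legPhi2 x) ^ 2 = 2 / 7 * Real.sqrt 5 := by
    rw [leg_poly_integral _ (Real.sqrt 5 ^ 2 * Real.sqrt 5) 1 (-18) 126 (-432) 756 (-648) 216
      (fun x => by simp only [legPhi2]; ring), s5]
    ring
  have ht : ∑' m : ℕ, l2 ^ (m + 1) * (2 / 5 * Real.sqrt 5) * (2 / 7 * Real.sqrt 5)
      = 4 / 7 * l2 * (1 - l2)⁻¹ := by
    rw [← tsum_geometric_of_abs_lt_one h2, ← tsum_mul_left]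
    congr 1
    funext m
    linear_combination (4 / 35 * l2 ^ (m + 1)) * s5
  have hne : 1 - l2 ≠ 0 := by
    have := (abs_lt.mp h2).2
    linarith
  simp only [Fin.sum_univ_two, Matrix.cons_val_zero, Matrix.cons_val_one, i1, i2, i3, i4, i5, i6,
    mul_zero, zero_mul, zero_add, ht]
  rw [mul_pow, s5]
  field_simp
  ring
end
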